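/- arXiv:2604.13239 — 2 statements merged into one kernel-verified Lean document; each statement's English description precedes it below -/
import Mathlib

section
/- Let T₁, …, Tₙ be bounded linear operators on a complex Hilbert space H. Then ‖∑_{k=1}^n T_k‖² ≤ ‖∑_{k=1}^n |T_k|‖ · ‖∑_{k=1}^n |T_k*|‖, where |T| = (T*T)^{1/2} denotes the absolute value of the operator T and ‖·‖ is the operator norm. -/
open ContinuousLinearMap

/-- The regularised inverse of `|T|`. -/
theorem aux_exists_inv {A : Type*} [CStarAlgebra A] [PartialOrder A] [StarOrderedRing A]
    (T : A) (ε : ℝ) (hε : 0 < ε) :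
    ∃ Q : A, 0 ≤ Q ∧ (CFC.sqrt (star T * T) + ε • 1) * Q = 1 ∧
      T * Q * star T ≤ CFC.sqrt (T * star T) := by
  have hA0 : 0 ≤ CFC.sqrt (star T * T) := CFC.sqrt_nonneg _
  have hAA : CFC.sqrt (star T * T) * CFC.sqrt (star T * T) = star T * T :=
    CFC.sqrt_mul_sqrt_self _ (star_mul_self_nonneg T)
  generalize CFC.sqrt (star T * T) = a at *
  have he : (0 : A) ≤ ε • (1 : A) := smul_nonneg hε.le zero_le_one
  have hes : IsStrictlyPositive (ε • (1 : A)) := by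
    refine ⟨he, ?_⟩
    rw [← Algebra.algebraMap_eq_smul_one]
    exact (IsUnit.mk0 ε hε.ne').map (algebraMap ℝ A)
  have hP : IsStrictlyPositive (a + ε • (1 : A)) := IsStrictlyPositive.nonneg_add hA0 hes
  have hQ0 := hP.ringInverse.nonneg
  have hPQ := Ring.mul_inverse_cancel _ hP.isUnit
  have hQP := Ring.inverse_mul_cancel _ hP.isUnit
  refine ⟨Ring.inverse (a + ε • (1 : A)), hQ0, hPQ, ?_⟩
  generalize Ring.inverse (a + ε • (1 : A)) = Q at *
  have h1 : a * a ≤ (a + ε • (1 : A)) * (a + ε • (1 : A)) := by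
    have : (a + ε • (1 : A)) * (a + ε • (1 : A)) = a * a + ((2 * ε) • a + (ε * ε) • 1) := by
      simp only [add_mul, mul_add, smul_mul_assoc, mul_smul_comm, one_mul, mul_one]
      module
    rw [this]
    refine le_add_of_nonneg_right (add_nonneg (smul_nonneg (by positivity) hA0)
      (smul_nonneg (by positivity) zero_le_one))
  have h2 : Q * (a * a) * Q ≤ 1 := by
    refine (conjugate_le_conjugate_of_nonneg h1 hQ0).trans_eq ?_
    rw [← mul_assoc, hQP, one_mul, hPQ]
  have h3 : (T * Q * star T) * (T * Q * star T) ≤ T * star T := by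
    have := star_right_conjugate_le_conjugate h2 T
    rw [hAA] at this
    simpa [mul_assoc] using this
  have h4 : 0 ≤ T * Q * star T := star_right_conjugate_nonneg hQ0 T
  calc T * Q * star T = CFC.sqrt ((T * Q * star T) * (T * Q * star T)) :=
        (CFC.sqrt_mul_self _ h4).symm
    _ ≤ _ := CFC.sqrt_le_sqrt _ _ h3

/-- Mixed Schwarz inequality, additive form. -/
theorem aux_mixed {H : Type*} [NormedAddCommGroup H] [InnerProductSpace ℂ H]
    [CompleteSpace H] (T : H →L[ℂ] H) (x y : H) :
    2 * (inner ℂ (T x) y).re ≤ (inner ℂ (CFC.sqrt (adjoint T * T) x) x).re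
      + (inner ℂ (CFC.sqrt (T * adjoint T) y) y).re := by
  have key : ∀ ε : ℝ, 0 < ε → 2 * (inner ℂ (T x) y).re ≤
      ((inner ℂ (CFC.sqrt (adjoint T * T) x) x).re
      + (inner ℂ (CFC.sqrt (T * adjoint T) y) y).re) + ε * ‖x‖ ^ 2 := by
    intro ε hε
    obtain ⟨Q, hQ0, hPQ, hle⟩ := aux_exists_inv T ε hε
    rw [star_eq_adjoint] at hPQ hle
    have hA0 : 0 ≤ CFC.sqrt (adjoint T * T) := CFC.sqrt_nonneg _
    generalize CFC.sqrt (adjoint T * T) = a at *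
    generalize CFC.sqrt (T * adjoint T) = b at *
    have hP0 : 0 ≤ a + ε • (1 : H →L[ℂ] H) :=
      add_nonneg hA0 (smul_nonneg hε.le zero_le_one)
    have h1 := ((nonneg_iff_isPositive _).1 hP0).re_inner_nonneg_left (x - Q (adjoint T y))
    have hs := ((nonneg_iff_isPositive _).1 hP0).inner_left_eq_inner_right x (Q (adjoint T y))
    have h2 := ((le_def _ _).1 hle).re_inner_nonneg_left y
    have hPQ' : (a + ε • (1 : H →L[ℂ] H)) (Q (adjoint T y)) = adjoint T y :=
      congrArg (fun f : H →L[ℂ] H => f (adjoint T y)) hPQ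
    have h3 : (inner ℂ ((a + ε • (1 : H →L[ℂ] H)) x) x).re
        = (inner ℂ (a x) x).re + ε * ‖x‖ ^ 2 := by
      have : (inner ℂ (ε • x) x).re = ε * ‖x‖ ^ 2 := by
        rw [inner_smul_left_eq_smul, inner_self_eq_norm_sq_to_K]
        simp [← Complex.ofReal_pow]
      have h : (a + ε • (1 : H →L[ℂ] H)) x = a x + ε • x := rfl
      rw [h, inner_add_left, Complex.add_re, this]
    have h4 : (inner ℂ (adjoint T y) (Q (adjoint T y))).re
        = (inner ℂ (T (Q (adjoint T y))) y).re := by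
      rw [adjoint_inner_left]
      exact inner_re_symm (𝕜 := ℂ) _ _
    have h5 : (inner ℂ (adjoint T y) x).re = (inner ℂ (T x) y).re := by
      rw [adjoint_inner_left]
      exact inner_re_symm (𝕜 := ℂ) _ _
    rw [hPQ', adjoint_inner_right] at hs
    rw [map_sub, hPQ', inner_sub_left, inner_sub_right, inner_sub_right, hs] at h1
    simp only [sub_apply, inner_sub_left, map_sub, RCLike.re_to_complex] at h1 h2
    rw [h3, h4, h5] at h1
    have h6 : (T * Q * adjoint T) y = T (Q (adjoint T y)) := rfl
    rw [h6] at h2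
    linarith
  refine le_of_forall_pos_le_add fun δ hδ => ?_
  have h := key (δ / (‖x‖ ^ 2 + 1)) (by positivity)
  have : δ / (‖x‖ ^ 2 + 1) * ‖x‖ ^ 2 ≤ δ := by
    rw [div_mul_eq_mul_div, div_le_iff₀ (by positivity)]
    nlinarith
  linarith

/-- `‖∑ T k‖² ≤ ‖∑ |T k|‖ * ‖∑ |T k *|‖`, where `|T| = (T† T)^{1/2}`. -/
theorem norm_sum_sq_le_abs_sums {H : Type*} [NormedAddCommGroup H] [InnerProductSpace ℂ H]
    [CompleteSpace H] {n : ℕ} (T : Fin n → (H →L[ℂ] H)) :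
    ‖∑ k, T k‖ ^ 2 ≤
      ‖∑ k, CFC.sqrt (adjoint (T k) * T k)‖ * ‖∑ k, CFC.sqrt (T k * adjoint (T k))‖ := by
  have hsum : ∀ x y : H, 2 * (inner ℂ ((∑ k, T k) x) y).re ≤
      (inner ℂ ((∑ k, CFC.sqrt (adjoint (T k) * T k)) x) x).re
      + (inner ℂ ((∑ k, CFC.sqrt (T k * adjoint (T k))) y) y).re := by
    intro x y
    simp only [sum_apply, sum_inner, Complex.re_sum, Finset.mul_sum, ← Finset.sum_add_distrib]
    exact Finset.sum_le_sum fun k _ => aux_mixed (T k) x y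
  generalize (∑ k, T k) = S at *
  generalize (∑ k, CFC.sqrt (adjoint (T k) * T k)) = a at *
  generalize (∑ k, CFC.sqrt (T k * adjoint (T k))) = b at *
  have bd : ∀ (c : H →L[ℂ] H) (z : H), (inner ℂ (c z) z).re ≤ ‖c‖ * ‖z‖ ^ 2 := by
    intro c z
    calc (inner ℂ (c z) z).re ≤ ‖c z‖ * ‖z‖ := re_inner_le_norm (𝕜 := ℂ) _ _
      _ ≤ (‖c‖ * ‖z‖) * ‖z‖ := by gcongr; exact c.le_opNorm z
      _ = _ := by ring
  have main : ∀ x, ‖S x‖ ^ 2 ≤ ‖a‖ * ‖b‖ * ‖x‖ ^ 2 := by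
    intro x
    have hq : ∀ s : ℝ, 0 ≤ (‖b‖ * ‖S x‖ ^ 2) * (s * s) + (-(2 * ‖S x‖ ^ 2)) * s
        + ‖a‖ * ‖x‖ ^ 2 := by
      intro s
      have h := hsum x (s • S x)
      have h1 := bd a x
      have h2 := bd b (s • S x)
      have h3 : (inner ℂ (S x) (s • S x)).re = s * ‖S x‖ ^ 2 := by
        rw [inner_smul_right_eq_smul, inner_self_eq_norm_sq_to_K]
        simp [← Complex.ofReal_pow]
      rw [norm_smul, mul_pow, Real.norm_eq_abs, sq_abs] at h2
      rw [h3] at h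
      nlinarith
    have hd := discrim_le_zero hq
    unfold discrim at hd
    rcases eq_or_lt_of_le (sq_nonneg ‖S x‖) with h0 | h0
    · rw [← h0]; positivity
    · refine le_of_mul_le_mul_left ?_ h0
      nlinarith
  have hS : ‖S‖ ≤ Real.sqrt (‖a‖ * ‖b‖) := by
    refine S.opNorm_le_bound (Real.sqrt_nonneg _) fun x => ?_
    refine le_of_sq_le_sq ?_ (by positivity)
    rw [mul_pow, Real.sq_sqrt (by positivity)]
    exact main x
  calc ‖S‖ ^ 2 ≤ Real.sqrt (‖a‖ * ‖b‖) ^ 2 := by gcongr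
    _ = _ := Real.sq_sqrt (by positivity)
end

section
/- Let T₁, …, Tₙ be bounded linear operators on a complex Hilbert space H, and let 1 ≤ m ≤ n. Then for every vector x ∈ H, ‖∑_{k=m}^n T_k x‖² ≤ (∑_{k=m}^n ⟨|T_k| x, x⟩) · ‖∑_{k=m}^n |T_k*|‖, where |T| = (T*T)^{1/2}. -/
set_option synthInstance.maxHeartbeats 1000000

open ContinuousLinearMap
open scoped InnerProductSpace

theorem pos_cs {H : Type*} [NormedAddCommGroup H] [InnerProductSpace ℂ H]
    [CompleteSpace H] (A : H →L[ℂ] H) (hA : 0 ≤ A) (x w : H) :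
    ‖⟪x, A w⟫_ℂ‖ ^ 2 ≤ (⟪A x, x⟫_ℂ).re * (⟪A w, w⟫_ℂ).re := by
  have hs : 0 ≤ CFC.sqrt A := CFC.sqrt_nonneg A
  have hp := (nonneg_iff_isPositive _).1 hs
  have hm : ∀ z, A z = CFC.sqrt A (CFC.sqrt A z) := fun z => by
    conv_lhs => rw [← CFC.sqrt_mul_sqrt_self A hA]
    rfl
  have hn : ∀ z, (⟪A z, z⟫_ℂ).re = ‖CFC.sqrt A z‖ ^ 2 := fun z => by
    rw [hm, hp.inner_left_eq_inner_right]
    exact (norm_sq_eq_re_inner (𝕜 := ℂ) _).symm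
  rw [hn, hn, hm, ← hp.inner_left_eq_inner_right, ← mul_pow]
  gcongr
  exact norm_inner_le_norm _ _

open scoped ComplexOrder in
theorem mixed_eps {H : Type*} [NormedAddCommGroup H] [InnerProductSpace ℂ H]
    [CompleteSpace H] (T : H →L[ℂ] H) (x y : H) (ε : ℝ) (hε : 0 < ε) :
    ‖⟪T x, y⟫_ℂ‖ ^ 2 ≤ ((⟪CFC.sqrt (adjoint T * T) x, x⟫_ℂ).re + ε * ‖x‖ ^ 2) *
      (⟪CFC.sqrt (T * adjoint T) y, y⟫_ℂ).re := by
  set P := CFC.sqrt (adjoint T * T) with hP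
  set Q := CFC.sqrt (T * adjoint T) with hQ
  have hP0 : 0 ≤ P := CFC.sqrt_nonneg _
  have hPP : P * P = star T * T := CFC.sqrt_mul_sqrt_self _ (star_mul_self_nonneg T)
  have hPp := (nonneg_iff_isPositive _).1 hP0
  have hε0 : (0 : ℂ) ≤ (ε : ℂ) := by exact_mod_cast hε.le
  have h1p : (((ε : ℂ) • (1 : H →L[ℂ] H))).IsPositive := isPositive_one.smul_of_nonneg hε0
  set A : H →L[ℂ] H := P + (ε : ℂ) • 1 with hA
  have hAp : A.IsPositive := hPp.add h1p
  have hA0 : 0 ≤ A := (nonneg_iff_isPositive _).2 hAp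
  have hAx : ∀ z, (⟪A z, z⟫_ℂ).re = (⟪P z, z⟫_ℂ).re + ε * ‖z‖ ^ 2 := fun z => by
    simp [hA, inner_add_left, inner_smul_left, inner_self_eq_norm_sq_to_K]
    norm_cast
    exact Or.inl rfl
  have hu : IsUnit A := by
    refine isUnit_of_forall_le_norm_inner_map A (c := ⟨ε, hε.le⟩) hε fun z => ?_
    refine le_trans ?_ (Complex.re_le_norm _)
    rw [hAx]
    have := hPp.re_inner_nonneg_left z
    have h2 : 0 ≤ (⟪P z, z⟫_ℂ).re := this
    change ‖z‖ ^ 2 * ε ≤ _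
    nlinarith
  obtain ⟨S, hAS, hSA⟩ : ∃ S, A * S = 1 ∧ S * A = 1 := 
    ⟨↑hu.unit⁻¹, hu.mul_val_inv, hu.val_inv_mul⟩
  have hAsa : star A = A := hAp.isSelfAdjoint
  have hSsa : star S = S := by
    have h : star S * A = 1 := by
      have := congrArg star hAS
      rwa [star_mul, hAsa, star_one] at this
    calc star S = star S * (A * S) := by rw [hAS, mul_one]
      _ = S := by rw [← mul_assoc, h, one_mul]
  have hS0 : 0 ≤ S := by
    have := star_left_conjugate_nonneg hA0 S
    rwa [hSsa, hSA, one_mul] at this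
  have hPA : P * P ≤ A * A := by
    rw [le_def]
    have : A * A - P * P = (ε : ℂ) • P + (ε : ℂ) • P + (ε : ℂ) • (ε : ℂ) • 1 := by
      rw [hA]; simp only [add_mul, mul_add, smul_add, smul_mul_assoc, mul_smul_comm, one_mul, mul_one]; abel
    rw [this]
    exact ((hPp.smul_of_nonneg hε0).add (hPp.smul_of_nonneg hε0)).add (h1p.smul_of_nonneg hε0)
  have hSP : S * (P * P) * S ≤ 1 := by
    have := star_left_conjugate_le_conjugate hPA S
    rw [hSsa] at this
    rwa [show S * (A * A) * S = (S * A) * (A * S) by noncomm_ring, hAS, hSA, one_mul] at this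
  have hR0 : 0 ≤ T * S * star T := star_right_conjugate_nonneg hS0 T
  have hRR : (T * S * star T) ^ 2 ≤ T * star T := by
    have := star_right_conjugate_le_conjugate hSP T
    rw [hPP, mul_one] at this
    calc _ = T * (S * (star T * T) * S) * star T := by noncomm_ring
      _ ≤ _ := this
  have hRQ : T * S * star T ≤ Q := by
    have := CFC.sqrt_le_sqrt _ _ hRR
    rwa [CFC.sqrt_sq _ hR0] at this
  have hAw : A (S (star T y)) = star T y := by
    exact congrArg (fun B : H →L[ℂ] H => B (star T y)) hAS
  have hcs := pos_cs A hA0 x (S (star T y))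
  rw [hAw, hAx, star_eq_adjoint, adjoint_inner_right] at hcs
  refine hcs.trans ?_
  have h3 : 0 ≤ (⟪P x, x⟫_ℂ).re := hPp.re_inner_nonneg_left x
  refine mul_le_mul_of_nonneg_left ?_ (by positivity)
  have h4 := ((le_def _ _).1 hRQ).re_inner_nonneg_left y
  have h5 : 0 ≤ (⟪Q y - T (S (adjoint T y)), y⟫_ℂ).re := h4
  rw [inner_sub_left, Complex.sub_re] at h5
  have h6 : (⟪adjoint T y, S (adjoint T y)⟫_ℂ).re = (⟪T (S (adjoint T y)), y⟫_ℂ).re := by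
    rw [adjoint_inner_left, ← Complex.conj_re, inner_conj_symm]
  have h7 : (⟪S (adjoint T y), adjoint T y⟫_ℂ).re = (⟪adjoint T y, S (adjoint T y)⟫_ℂ).re := by
    rw [← Complex.conj_re, inner_conj_symm]
  linarith

theorem mixed_schwarz {H : Type*} [NormedAddCommGroup H] [InnerProductSpace ℂ H]
    [CompleteSpace H] (T : H →L[ℂ] H) (x y : H) :
    ‖⟪T x, y⟫_ℂ‖ ^ 2 ≤ (⟪CFC.sqrt (adjoint T * T) x, x⟫_ℂ).re *
      (⟪CFC.sqrt (T * adjoint T) y, y⟫_ℂ).re := by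
  have hc : Continuous fun ε : ℝ => ((⟪CFC.sqrt (adjoint T * T) x, x⟫_ℂ).re + ε * ‖x‖ ^ 2) *
      (⟪CFC.sqrt (T * adjoint T) y, y⟫_ℂ).re := by fun_prop
  have ht := (hc.tendsto 0).mono_left (nhdsWithin_le_nhds (s := Set.Ioi 0))
  simp only [zero_mul, add_zero] at ht
  refine ge_of_tendsto ht ?_
  filter_upwards [self_mem_nhdsWithin] with ε hε
  exact mixed_eps T x y ε hε

/-- For every vector `x`,
`‖∑_{k=m}^n T k x‖² ≤ (∑_{k=m}^n ⟨|T k| x, x⟩) * ‖∑_{k=m}^n |T k *|‖`. -/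
theorem tail_cauchy_bound {H : Type*} [NormedAddCommGroup H] [InnerProductSpace ℂ H]
    [CompleteSpace H] (T : ℕ → (H →L[ℂ] H)) (m n : ℕ) (hm : 1 ≤ m) (hmn : m ≤ n) (x : H) :
    ‖(∑ k ∈ Finset.Icc m n, T k) x‖ ^ 2 ≤
      (∑ k ∈ Finset.Icc m n, (⟪CFC.sqrt (adjoint (T k) * T k) x, x⟫_ℂ).re) *
        ‖∑ k ∈ Finset.Icc m n, CFC.sqrt (T k * adjoint (T k))‖ := by
  have hpos : ∀ (B : H →L[ℂ] H) (z : H), 0 ≤ (⟪CFC.sqrt B z, z⟫_ℂ).re := fun B z =>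
    ((nonneg_iff_isPositive _).1 (CFC.sqrt_nonneg B)).re_inner_nonneg_left z
  set y := (∑ k ∈ Finset.Icc m n, T k) x with hy
  have hcs := Finset.sum_sq_le_sum_mul_sum_of_sq_le_mul (Finset.Icc m n)
    (r := fun k => ‖⟪T k x, y⟫_ℂ‖)
    (f := fun k => (⟪CFC.sqrt (adjoint (T k) * T k) x, x⟫_ℂ).re)
    (g := fun k => (⟪CFC.sqrt (T k * adjoint (T k)) y, y⟫_ℂ).re)
    (fun k _ => hpos _ _) (fun k _ => hpos _ _) (fun k _ => mixed_schwarz (T k) x y)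
  have h1 : ‖y‖ ^ 2 ≤ ∑ k ∈ Finset.Icc m n, ‖⟪T k x, y⟫_ℂ‖ := by
    refine le_trans ?_ (norm_sum_le _ _)
    rw [← sum_inner, ← ContinuousLinearMap.sum_apply, ← hy, inner_self_eq_norm_sq_to_K]
    simp
  have h2 : ∑ k ∈ Finset.Icc m n, (⟪CFC.sqrt (T k * adjoint (T k)) y, y⟫_ℂ).re ≤
      ‖∑ k ∈ Finset.Icc m n, CFC.sqrt (T k * adjoint (T k))‖ * ‖y‖ ^ 2 := by
    rw [← Complex.re_sum, ← sum_inner, ← ContinuousLinearMap.sum_apply]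
    refine (Complex.re_le_norm _).trans ((norm_inner_le_norm _ _).trans ?_)
    rw [pow_two, ← mul_assoc]
    gcongr
    exact le_opNorm _ _
  have ha : 0 ≤ ∑ k ∈ Finset.Icc m n, (⟪CFC.sqrt (adjoint (T k) * T k) x, x⟫_ℂ).re :=
    Finset.sum_nonneg fun k _ => hpos _ _
  have h3 : (‖y‖ ^ 2) ^ 2 ≤ (∑ k ∈ Finset.Icc m n, ‖⟪T k x, y⟫_ℂ‖) ^ 2 := by gcongr
  have h4 := h3.trans (hcs.trans (mul_le_mul_of_nonneg_left h2 ha))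
  rcases (sq_nonneg ‖y‖).eq_or_lt with h0 | h0
  · rw [← h0]; positivity
  · refine le_of_mul_le_mul_right ?_ h0
    linarith
end
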